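/- arXiv:2009.14141 — 2 statements merged into one kernel-verified Lean document; each statement's English description precedes it below -/
import Mathlib

section
/- For n ≥ 1, the coefficient of h_μ in p_n equals n·(-1)^{l(μ)-1}(l(μ)-1)!/∏_i n_i(μ)! for every partition μ of n. -/
open Finset
open scoped Classical

noncomputable section

/-- `∏ i, n_i(m)!` where `n_i(m)` is the multiplicity of `i` in the multiset `m`. -/
def multFact (m : Multiset ℕ) : ℕ := ∏ j ∈ m.toFinset, (m.count j).factorial

/-- The power-sum symmetric function `p_m = ∑_k x_k^m`. -/
def pPow (m : ℕ) : MvPowerSeries ℕ ℚ :=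
  fun d => if ∃ k, d = Finsupp.single k m then 1 else 0

/-- The complete homogeneous symmetric function `h_m`. -/
def hPow (m : ℕ) : MvPowerSeries ℕ ℚ :=
  fun d => if (d.sum fun _ v => v) = m then 1 else 0

/-- `h_μ = h_{μ_1} ⋯ h_{μ_k}` for a multiset of parts. -/
def hProd (mm : Multiset ℕ) : MvPowerSeries ℕ ℚ := (mm.map hPow).prod

namespace HP

def Rel {A : Type*} [CommRing A] (N : ℕ) (c d : ℕ → A) : Prop :=
  ∀ m, 1 ≤ m → m ≤ N → ∑ p ∈ antidiagonal m, (-1 : A) ^ p.1 * c p.1 * d p.2 = 0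

lemma Rel.symm {A : Type*} [CommRing A] {N : ℕ} {c d : ℕ → A} (h : Rel N c d) : Rel N d c := by
  intro m h1 h2
  have := congrArg (fun x => (-1 : A) ^ m * x) (h m h1 h2)
  simp only [mul_zero, Finset.mul_sum] at this
  rw [← this, ← Finset.Nat.sum_antidiagonal_swap]
  apply Finset.sum_congr rfl
  rintro ⟨i, j⟩ hp
  rw [HasAntidiagonal.mem_antidiagonal] at hp
  simp only [Prod.swap] at *
  have e : (-1 : A) ^ m * (-1) ^ i = (-1) ^ j := by
    rw [← hp, pow_add, mul_right_comm, ← mul_pow]; simp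
  rw [← e]; ring

lemma Rel.congr {A : Type*} [CommRing A] {N : ℕ} {c c' d : ℕ → A} (h : Rel N c d)
    (hc : ∀ m ≤ N, c m = c' m) : Rel N c' d := by
  intro m h1 h2
  rw [← h m h1 h2]
  apply Finset.sum_congr rfl
  rintro ⟨i, j⟩ hp
  rw [HasAntidiagonal.mem_antidiagonal] at hp
  simp only at *
  rw [hc i (by omega)]

lemma Rel.uniq {A : Type*} [CommRing A] {N : ℕ} {c d d' : ℕ → A} (h : Rel N c d)
    (h' : Rel N c d') (hc : c 0 = 1) (h0 : d 0 = d' 0) : ∀ m ≤ N, d m = d' m := by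
  intro m
  induction m using Nat.strong_induction_on with
  | _ m ih =>
    intro hm
    rcases Nat.eq_zero_or_pos m with rfl | hpos
    · exact h0
    obtain ⟨k, rfl⟩ : ∃ k, m = k + 1 := ⟨m - 1, by omega⟩
    have e1 := h _ hpos hm
    have e2 := h' _ hpos hm
    rw [Finset.Nat.sum_antidiagonal_succ] at e1 e2
    simp only [pow_zero, hc, one_mul] at e1 e2
    have : ∑ p ∈ antidiagonal k, (-1 : A) ^ (p.1+1) * c (p.1+1) * d p.2 =
        ∑ p ∈ antidiagonal k, (-1 : A) ^ (p.1+1) * c (p.1+1) * d' p.2 := by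
      apply Finset.sum_congr rfl
      rintro ⟨i, j⟩ hp
      rw [HasAntidiagonal.mem_antidiagonal] at hp
      simp only at *
      rw [ih j (by omega) (by omega)]
    rw [this] at e1
    exact add_right_cancel (e1.trans e2.symm)

lemma Rel.map {A B : Type*} [CommRing A] [CommRing B] {N : ℕ} {c d : ℕ → A} (h : Rel N c d)
    (f : A →+* B) : Rel N (fun m => f (c m)) (fun m => f (d m)) := by
  intro m h1 h2
  have := congrArg f (h m h1 h2)
  simpa using this

lemma exists_rel {A : Type*} [CommRing A] (c : ℕ → A) (hc : c 0 = 1) :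
    ∃ d : ℕ → A, d 0 = 1 ∧ ∀ N, Rel N c d := by
  set F : PowerSeries A := PowerSeries.mk fun i => (-1) ^ i * c i with hF
  set G := PowerSeries.invOfUnit F 1
  have hFG : F * G = 1 := PowerSeries.mul_invOfUnit F 1 (by simp [hF, hc])
  refine ⟨fun m => PowerSeries.coeff m G, ?_, ?_⟩
  · simp [G]
  · intro N m h1 h2
    have := congrArg (PowerSeries.coeff m) hFG
    rw [PowerSeries.coeff_mul, PowerSeries.coeff_one, if_neg (by omega)] at this
    rw [← this]
    simp [hF]

open MvPolynomial in
/-- generators -/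
def gen (n m : ℕ) : MvPolynomial (Fin n) ℚ :=
  if m = 0 then 1 else if h : m - 1 < n then X ⟨m - 1, h⟩ else 0

open MvPolynomial in
lemma gen_aeval {n : ℕ} {A : Type*} [CommRing A] [Algebra ℚ A] (c : ℕ → A) (hc : c 0 = 1) :
    ∀ m ≤ n, aeval (fun i : Fin n => c (i + 1)) (gen n m) = c m := by
  intro m hm
  unfold gen
  split_ifs with h1 h2
  · simp [h1, hc]
  · rw [aeval_X]; congr 1; simp; omega
  · omega

open MvPolynomial in
lemma gen_succ {n : ℕ} (i : Fin n) : gen n (i + 1) = X i := by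
  simp [gen]

open MvPolynomial in
lemma inj_of_rel {n : ℕ} {A : Type*} [CommRing A] [Algebra ℚ A] (e h : ℕ → A) (he : e 0 = 1)
    (hh : h 0 = 1) (hr : Rel n e h)
    (hinj : Function.Injective (aeval (fun i : Fin n => e (i + 1)) :
      MvPolynomial (Fin n) ℚ →ₐ[ℚ] A)) :
    Function.Injective (aeval (fun i : Fin n => h (i + 1)) : MvPolynomial (Fin n) ℚ →ₐ[ℚ] A) := by
  obtain ⟨d, d0, hd⟩ := exists_rel (gen n) (by simp [gen])
  set ψ : MvPolynomial (Fin n) ℚ →ₐ[ℚ] A := aeval (fun i : Fin n => e (i + 1)) with hψ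
  set θ : MvPolynomial (Fin n) ℚ →ₐ[ℚ] MvPolynomial (Fin n) ℚ :=
    aeval (fun i : Fin n => d (i + 1)) with hθ
  have h1 : ∀ m ≤ n, ψ (d m) = h m := by
    have r1 : Rel n e (fun m => ψ (d m)) :=
      ((hd n).map ψ.toRingHom).congr (fun m hm => gen_aeval e he m hm)
    exact r1.uniq hr he (by simp [d0, hh])
  have h2 : ∀ m ≤ n, θ (d m) = gen n m := by
    have r1 : Rel n d (fun m => θ (d m)) :=
      ((hd n).map θ.toRingHom).congr (fun m hm => gen_aeval d d0 m hm)
    exact r1.uniq (hd n).symm d0 (by simp [d0, gen])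
  have h3 : (aeval (fun i : Fin n => h (i + 1)) : MvPolynomial (Fin n) ℚ →ₐ[ℚ] A) = ψ.comp θ := by
    ext i
    simp only [aeval_X, AlgHom.comp_apply, hθ]
    exact (h1 _ (by omega)).symm
  have h4 : θ.comp θ = AlgHom.id _ _ := by
    ext1 i
    rw [AlgHom.comp_apply]
    conv_lhs => rw [hθ]; rw [aeval_X]; 
    rw [← hθ, h2 _ (by omega), gen_succ]; rfl
  rw [h3, AlgHom.coe_comp]
  refine hinj.comp ?_
  intro x y hxy
  have := congrArg θ hxy
  simpa [← AlgHom.comp_apply, h4] using this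


/-- size of an exponent -/
def sz {n : ℕ} (d : Fin n →₀ ℕ) : ℕ := ∑ i, d i

lemma sz_add {n : ℕ} (d d' : Fin n →₀ ℕ) : sz (d + d') = sz d + sz d' := by
  simp [sz, Finset.sum_add_distrib]

lemma sz_single {n : ℕ} (i : Fin n) (k : ℕ) : sz (Finsupp.single i k) = k := by
  simp [sz, Finsupp.single_apply]

def hF (n m : ℕ) : MvPowerSeries (Fin n) ℚ := fun d => if sz d = m then 1 else 0

lemma coeff_hF {n m : ℕ} (d : Fin n →₀ ℕ) :
    MvPowerSeries.coeff d (hF n m) = if sz d = m then 1 else 0 := rfl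

def ind {n : ℕ} (t : Finset (Fin n)) : Fin n →₀ ℕ := ∑ i ∈ t, Finsupp.single i 1

lemma ind_apply {n : ℕ} (t : Finset (Fin n)) (i : Fin n) : ind t i = if i ∈ t then 1 else 0 := by
  simp [ind, Finsupp.finsetSum_apply, Finsupp.single_apply]

lemma sz_ind {n : ℕ} (t : Finset (Fin n)) : sz (ind t) = t.card := by
  simp [sz, ind_apply]

lemma ind_le {n : ℕ} (t : Finset (Fin n)) (d : Fin n →₀ ℕ) : ind t ≤ d ↔ t ⊆ d.support := by
  rw [Finsupp.le_def]
  constructor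
  · intro h i hi
    have := h i
    rw [ind_apply, if_pos hi] at this
    rw [Finsupp.mem_support_iff]; omega
  · intro h i
    rw [ind_apply]
    split_ifs with hi
    · have := h hi
      rw [Finsupp.mem_support_iff] at this; omega
    · omega

def eF (n m : ℕ) : MvPowerSeries (Fin n) ℚ :=
  ∑ t ∈ powersetCard m univ, MvPowerSeries.monomial (ind t) 1

lemma eF_eq (n m : ℕ) : eF n m = ((MvPolynomial.esymm (Fin n) ℚ m : MvPolynomial (Fin n) ℚ) :
    MvPowerSeries (Fin n) ℚ) := by
  rw [MvPolynomial.esymm_eq_sum_monomial, ← MvPolynomial.coeToMvPowerSeries.ringHom_apply, map_sum]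
  simp [eF, ind]

lemma sz_sub {n : ℕ} {d e : Fin n →₀ ℕ} (h : e ≤ d) : sz (d - e) + sz e = sz d := by
  rw [← sz_add, tsub_add_cancel_of_le h]

lemma rel_eh (n : ℕ) (N : ℕ) : Rel N (eF n) (hF n) := by
  intro m h1 _
  ext d
  have key : ∀ p ∈ HasAntidiagonal.antidiagonal m,
      MvPowerSeries.coeff d ((-1) ^ p.1 * eF n p.1 * hF n p.2) =
      if sz d = m then ∑ t ∈ d.support.powerset with t.card = p.1, (-1 : ℚ) ^ t.card else 0 := by
    rintro ⟨i, j⟩ hp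
    rw [HasAntidiagonal.mem_antidiagonal] at hp
    simp only at hp ⊢
    have e0 : ((-1 : MvPowerSeries (Fin n) ℚ) ^ i) = MvPowerSeries.C ((-1 : ℚ) ^ i) := by
      simp
    rw [e0, mul_assoc, MvPowerSeries.coeff_C_mul, eF, Finset.sum_mul, map_sum, Finset.mul_sum]
    have e1 : (d.support.powerset.filter fun t => t.card = i) =
        (powersetCard i univ).filter fun t => t ⊆ d.support := by
      ext t; simp [Finset.mem_powersetCard]; tauto
    rw [e1, Finset.sum_filter]
    split_ifs with hd
    · apply Finset.sum_congr rfl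
      intro t ht
      rw [Finset.mem_powersetCard_univ] at ht
      rw [MvPowerSeries.coeff_monomial_mul, coeff_hF]
      simp only [ind_le]
      split_ifs with h2 h3
      · simp [ht]
      · have := sz_sub ((ind_le t d).2 h2)
        rw [sz_ind] at this; omega
      · simp
    · apply Finset.sum_eq_zero
      intro t ht
      rw [Finset.mem_powersetCard_univ] at ht
      rw [MvPowerSeries.coeff_monomial_mul, coeff_hF]
      simp only [ind_le]
      split_ifs with h2 h3
      · have := sz_sub ((ind_le t d).2 h2)
        rw [sz_ind] at this; omega
      · simp
      · simp
  rw [map_sum, Finset.sum_congr rfl key, map_zero]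
  by_cases hd : sz d = m
  · simp only [hd, if_true]
    rw [Finset.Nat.sum_antidiagonal_eq_sum_range_succ_mk, Finset.sum_fiberwise_of_maps_to]
    · have hne : d.support.Nonempty := by
        rw [Finset.nonempty_iff_ne_empty]
        intro h0
        rw [Finsupp.support_eq_empty] at h0
        simp [h0, sz] at hd
        omega
      have := Finset.sum_powerset_neg_one_pow_card_of_nonempty hne
      exact_mod_cast this
    · intro t ht
      rw [Finset.mem_powerset] at ht
      have := sz_sub ((ind_le t d).2 ht)
      rw [sz_ind] at this
      rw [Finset.mem_range]; omega
  · simp [hd]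

lemma hF_zero (n : ℕ) : hF n 0 = 1 := by
  ext d
  rw [coeff_hF, MvPowerSeries.coeff_one]
  congr 1
  simp [sz, Finsupp.ext_iff]

open MvPolynomial in
lemma inj_h (n : ℕ) : Function.Injective
    (aeval (fun i : Fin n => hF n (i + 1)) :
      MvPolynomial (Fin n) ℚ →ₐ[ℚ] MvPowerSeries (Fin n) ℚ) := by
  refine inj_of_rel (eF n) (hF n) (by simp [eF_eq]) (hF_zero n) (rel_eh n n) ?_
  have h1 : (aeval (fun i : Fin n => eF n (i + 1)) :
      MvPolynomial (Fin n) ℚ →ₐ[ℚ] MvPowerSeries (Fin n) ℚ) =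
      (coeToMvPowerSeries.algHom ℚ).comp (aeval (fun i : Fin n => esymm (Fin n) ℚ (i + 1))) := by
    ext1 i
    simp [eF_eq]
  rw [h1, AlgHom.coe_comp]
  refine Function.Injective.comp ?_ ?_
  · intro x y hxy
    simpa using hxy
  · intro x y hxy
    apply esymmAlgHom_fin_injective ℚ (le_refl n)
    apply Subtype.ext
    rw [esymmAlgHom_apply, esymmAlgHom_apply]
    exact hxy

/-- power sums -/
def pF (n m : ℕ) : MvPowerSeries (Fin n) ℚ :=
  ∑ j : Fin n, MvPowerSeries.monomial (Finsupp.single j m) 1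

lemma newton (n m : ℕ) : (m : MvPowerSeries (Fin n) ℚ) * hF n m =
    ∑ i ∈ Icc 1 m, pF n i * hF n (m - i) := by
  ext d
  have e0 : (m : MvPowerSeries (Fin n) ℚ) = MvPowerSeries.C (m : ℚ) := by simp
  rw [e0, MvPowerSeries.coeff_C_mul, coeff_hF, map_sum]
  have key : ∀ i ∈ Icc 1 m, MvPowerSeries.coeff d (pF n i * hF n (m - i)) =
      ∑ j : Fin n, if i ≤ d j then (if sz d = m then (1 : ℚ) else 0) else 0 := by
    intro i hi
    rw [Finset.mem_Icc] at hi
    rw [pF, Finset.sum_mul, map_sum]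
    apply Finset.sum_congr rfl
    intro j _
    rw [MvPowerSeries.coeff_monomial_mul, coeff_hF]
    simp only [Finsupp.single_le_iff, one_mul]
    split_ifs with h1 h2 h3 h3
    all_goals try rfl
    all_goals
      have := sz_sub (Finsupp.single_le_iff.2 h1)
      rw [sz_single] at this
      omega
  rw [Finset.sum_congr rfl key, Finset.sum_comm]
  split_ifs with hd
  · rw [← hd]
    simp only [← Finset.sum_filter]
    rw [mul_one]
    unfold sz
    push_cast
    apply Finset.sum_congr rfl
    intro j _
    rw [Finset.sum_const]
    have : (Icc 1 (∑ i, d i)).filter (fun i => i ≤ d j) = Icc 1 (d j) := by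
      have := Finset.single_le_sum (f := fun i => d i) (fun i _ => Nat.zero_le _) (Finset.mem_univ j)
      ext x; simp; intro _ _; omega
    rw [this]; simp
  · simp


open MvPolynomial in
def PP (n : ℕ) (m : ℕ) : MvPolynomial (Fin n) ℚ :=
  (m : MvPolynomial (Fin n) ℚ) * gen n m -
    ∑ k : Fin n, if h : (k : ℕ) + 1 ≤ m then PP n (m - 1 - k) * X k else 0
termination_by m
decreasing_by omega

lemma PP_zero (n : ℕ) : PP n 0 = 0 := by
  rw [PP]; simp

open MvPolynomial in
lemma aeval_PP (n : ℕ) : ∀ m, 1 ≤ m → m ≤ n →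
    aeval (fun i : Fin n => hF n (i + 1)) (PP n m) = pF n m := by
  intro m
  induction m using Nat.strong_induction_on with
  | _ m ih =>
    intro h1 h2
    obtain ⟨M, rfl⟩ : ∃ M, m = M + 1 := ⟨m - 1, by omega⟩
    rw [PP, map_sub, map_mul, map_natCast, gen_aeval (hF n) (hF_zero n) _ h2, newton, map_sum]
    have e1 : ∀ k : Fin n, aeval (fun i : Fin n => hF n (i + 1))
        (if h : (k : ℕ) + 1 ≤ M + 1 then PP n (M + 1 - 1 - k) * X k else 0) =
        if (k : ℕ) < M then pF n (M - k) * hF n (k + 1) else 0 := by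
      intro k
      split_ifs with h3 h4 h4
      · rw [map_mul, aeval_X, show M + 1 - 1 - (k : ℕ) = M - k by omega,
          ih _ (by omega) (by omega) (by omega)]
      · rw [show M + 1 - 1 - (k : ℕ) = 0 by omega, PP_zero]; simp
      · omega
      · simp
    rw [Finset.sum_congr rfl (fun k _ => e1 k),
      Fin.sum_univ_eq_sum_range (fun k => if k < M then pF n (M - k) * hF n (k + 1) else 0) n,
      ← Finset.sum_filter]
    have e2 : (range n).filter (fun k => k < M) = range M := by
      ext x; simp; omega
    rw [e2]
    have e3 : ∑ i ∈ Icc 1 (M + 1), pF n i * hF n (M + 1 - i) =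
        ∑ j ∈ range (M + 1), pF n (j + 1) * hF n (M - j) := by
      have e4 : Icc 1 (M + 1) = (range (M + 1)).image (fun j => j + 1) := by
        ext x; simp only [mem_Icc, mem_image, mem_range]
        constructor
        · intro h; exact ⟨x - 1, by omega, by omega⟩
        · rintro ⟨a, h, rfl⟩; omega
      rw [e4, Finset.sum_image (by intro a _ b _ h; simpa using h)]
      apply Finset.sum_congr rfl
      intro j _
      congr 2; omega
    rw [e3, Finset.sum_range_succ, Nat.sub_self, hF_zero, mul_one, ← Finset.sum_range_reflect,
      sub_eq_iff_eq_add, add_comm]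
    congr 1
    apply Finset.sum_congr rfl
    intro j hj
    rw [mem_range] at hj
    congr 2 <;> omega

/-- weight of an exponent -/
def wt {n : ℕ} (d : Fin n →₀ ℕ) : ℕ := ∑ i : Fin n, ((i : ℕ) + 1) * d i

lemma wt_add {n : ℕ} (d d' : Fin n →₀ ℕ) : wt (d + d') = wt d + wt d' := by
  simp [wt, Finset.sum_add_distrib, mul_add]

lemma wt_single {n : ℕ} (i : Fin n) (k : ℕ) : wt (Finsupp.single i k) = (i + 1) * k := by
  simp [wt, Finsupp.single_apply]

def fp {n : ℕ} (d : Fin n →₀ ℕ) : ℚ := ∏ i, ((d i).factorial : ℚ)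

lemma fp_ne {n : ℕ} (d : Fin n →₀ ℕ) : fp d ≠ 0 := by
  unfold fp
  rw [Finset.prod_ne_zero_iff]
  intro i _
  exact_mod_cast (Nat.factorial_ne_zero _)

lemma fp_add {n : ℕ} (d : Fin n →₀ ℕ) (k : Fin n) :
    fp (d + Finsupp.single k 1) = (d k + 1) * fp d := by
  unfold fp
  rw [← Finset.mul_prod_erase _ _ (Finset.mem_univ k), ← Finset.mul_prod_erase univ
    (fun i => ((d i).factorial : ℚ)) (Finset.mem_univ k), ← mul_assoc]
  congr 1
  · simp [Nat.factorial_succ]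
  · apply Finset.prod_congr rfl
    intro i hi
    rw [Finset.mem_erase] at hi
    simp [Finsupp.single_apply, hi.1.symm]

lemma sz_pos_add {n : ℕ} (d : Fin n →₀ ℕ) (k : Fin n) (hk : d k ≠ 0) :
    ∃ d', d = d' + Finsupp.single k 1 := by
  refine ⟨d - Finsupp.single k 1, (tsub_add_cancel_of_le ?_).symm⟩
  rw [Finsupp.single_le_iff]; omega

lemma sz_eq_zero {n : ℕ} (d : Fin n →₀ ℕ) (h : sz d = 0) : d = 0 := by
  ext i
  simp [sz] at h
  simpa using h i

lemma sz_one {n : ℕ} (d : Fin n →₀ ℕ) (h : sz d = 1) : ∃ k, d = Finsupp.single k 1 := by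
  have : ∃ k, d k ≠ 0 := by
    by_contra! hc
    simp [sz, hc] at h
  obtain ⟨k, hk⟩ := this
  obtain ⟨d', rfl⟩ := sz_pos_add d k hk
  rw [sz_add, sz_single] at h
  have := sz_eq_zero d' (by omega)
  exact ⟨k, by simp [this]⟩

open MvPolynomial in
lemma coeff_PP (n : ℕ) : ∀ m ≤ n, ∀ d : Fin n →₀ ℕ, coeff d (PP n m) =
    if wt d = m then (m : ℚ) * (-1) ^ (sz d - 1) * ((sz d - 1).factorial : ℚ) / fp d else 0 := by
  intro m
  induction m using Nat.strong_induction_on with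
  | _ m ih =>
    intro hm d
    rcases Nat.eq_zero_or_pos m with rfl | hpos
    · simp [PP_zero]
    have term : ∀ k : Fin n, coeff d
        (if h : (k : ℕ) + 1 ≤ m then PP n (m - 1 - k) * X k else 0) =
        if wt d = m then ((m : ℚ) - ((k : ℕ) + 1)) * d k *
          ((-1) ^ (sz d - 2) * ((sz d - 2).factorial : ℚ) / fp d) else 0 := by
      intro k
      by_cases hk : d k = 0
      · have : coeff d (if h : (k : ℕ) + 1 ≤ m then PP n (m - 1 - k) * X k else 0) = 0 := by
          split_ifs with h
          · rw [coeff_mul_X', if_neg (by simpa using hk)]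
          · simp
        rw [this]; simp [hk]
      · obtain ⟨d', rfl⟩ := sz_pos_add d k hk
        have hw := wt_add d' (Finsupp.single k 1)
        rw [wt_single, mul_one] at hw
        split_ifs with h1 h2 h2
        · rw [coeff_mul_X, ih _ (by omega) (by omega), if_pos (by omega), sz_add, sz_single, fp_add]
          have e1 : ((m - 1 - (k : ℕ) : ℕ) : ℚ) = (m : ℚ) - ((k : ℕ) + 1) := by
            rw [Nat.sub_sub, Nat.cast_sub (by omega)]; push_cast; ring
          rw [e1, show sz d' + 1 - 2 = sz d' - 1 by omega]
          have := fp_ne d'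
          have h5 : ((d' k : ℚ) + 1) ≠ 0 := by positivity
          simp only [Finsupp.add_apply, Finsupp.single_eq_same]
          push_cast
          field_simp
        · rw [coeff_mul_X, ih _ (by omega) (by omega), if_neg (by omega)]
        · omega
        · simp
    have e0 : (m : MvPolynomial (Fin n) ℚ) = C (m : ℚ) := by simp
    obtain ⟨j, rfl⟩ : ∃ j : Fin n, m = j + 1 := ⟨⟨m - 1, by omega⟩, by simp; omega⟩
    rw [PP, coeff_sub, e0, coeff_C_mul, coeff_sum, Finset.sum_congr rfl (fun k _ => term k),
      gen_succ, coeff_X]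
    by_cases hw : wt d = j + 1
    · simp only [hw, if_true]
      rw [← Finset.sum_mul]
      have e1 : ∑ k : Fin n, (((j + 1 : ℕ) : ℚ) - ((k : ℕ) + 1)) * d k =
          ((j + 1 : ℕ) : ℚ) * ((sz d : ℚ) - 1) := by
        have : ((wt d : ℕ) : ℚ) = ((j + 1 : ℕ) : ℚ) := by rw [hw]
        rw [wt] at this
        push_cast at this
        simp only [sub_mul, Finset.sum_sub_distrib, this, ← Finset.mul_sum, sz]
        push_cast
        ring
      rw [e1]
      rcases h : sz d with _ | _ | s
      · rw [sz_eq_zero d h] at hw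
        simp [wt] at hw
      · obtain ⟨k, rfl⟩ := sz_one d h
        rw [wt_single] at hw
        have : k = j := by ext; omega
        subst this
        have : fp (Finsupp.single k 1) = 1 := by
          have := fp_add (0 : Fin n →₀ ℕ) k
          simpa [fp] using this
        simp [this]
      · rw [if_neg]
        · have := fp_ne d
          simp only [Nat.add_sub_cancel, show s + 1 + 1 - 1 = s + 1 by omega,
            show s + 1 + 1 - 2 = s by omega, Nat.factorial_succ, pow_succ]
          push_cast
          field_simp
          ring
        · rintro rfl
          rw [sz_single] at h; omega
    · simp only [hw, if_false]
      rw [if_neg]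
      · simp
      · rintro rfl
        rw [wt_single] at hw; omega


@[to_additive]
lemma prod_parts {M : Type*} [CommMonoid M] {n : ℕ} (s : Multiset ℕ)
    (hs : ∀ x ∈ s, 1 ≤ x ∧ x ≤ n) (F : ℕ → M) (hF : ∀ x, x ∉ s → F x = 1) :
    ∏ x ∈ s.toFinset, F x = ∏ i : Fin n, F (i + 1) := by
  rw [← Finset.prod_image (s := univ) (g := fun i : Fin n => (i : ℕ) + 1) (f := F)]
  · apply Finset.prod_subset
    · intro x hx
      rw [Multiset.mem_toFinset] at hx
      have := hs x hx
      rw [Finset.mem_image]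
      exact ⟨⟨x - 1, by omega⟩, Finset.mem_univ _, by simp; omega⟩
    · intro x _ hx
      rw [Multiset.mem_toFinset] at hx
      exact hF x hx
  · intro a _ b _ h
    ext; simpa using h

def dOf {n : ℕ} (nu : Nat.Partition n) : Fin n →₀ ℕ :=
  Finsupp.equivFunOnFinite.symm fun i => nu.parts.count ((i : ℕ) + 1)

lemma dOf_apply {n : ℕ} (nu : Nat.Partition n) (i : Fin n) :
    dOf nu i = nu.parts.count ((i : ℕ) + 1) := rfl

lemma parts_bd {n : ℕ} (nu : Nat.Partition n) : ∀ x ∈ nu.parts, 1 ≤ x ∧ x ≤ n := by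
  intro x hx
  refine ⟨nu.parts_pos hx, ?_⟩
  have := Multiset.single_le_sum (fun x _ => Nat.zero_le x) x hx
  rwa [nu.parts_sum] at this

lemma dOf_inj {n : ℕ} {nu mu : Nat.Partition n} (h : dOf nu = dOf mu) : nu = mu := by
  apply Nat.Partition.ext
  ext x
  by_cases hx : 1 ≤ x ∧ x ≤ n
  · have := DFunLike.congr_fun h ⟨x - 1, by omega⟩
    rw [dOf_apply, dOf_apply] at this
    simpa [Nat.sub_add_cancel hx.1] using this
  · rw [Multiset.count_eq_zero_of_notMem (fun hm => hx (parts_bd nu x hm)),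
      Multiset.count_eq_zero_of_notMem (fun hm => hx (parts_bd mu x hm))]

lemma sz_dOf {n : ℕ} (nu : Nat.Partition n) : sz (dOf nu) = nu.parts.card := by
  rw [← Multiset.toFinset_sum_count_eq, sum_parts nu.parts (parts_bd nu) _
    (fun x hx => Multiset.count_eq_zero_of_notMem hx)]
  rfl

lemma wt_dOf {n : ℕ} (nu : Nat.Partition n) : wt (dOf nu) = n := by
  conv_rhs => rw [← nu.parts_sum, Finset.sum_multiset_count]
  rw [sum_parts nu.parts (parts_bd nu) _
    (fun x hx => by rw [Multiset.count_eq_zero_of_notMem hx]; simp)]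
  simp [wt, dOf_apply, mul_comm]

lemma fp_dOf {n : ℕ} (nu : Nat.Partition n) : fp (dOf nu) = (multFact nu.parts : ℚ) := by
  rw [multFact, prod_parts nu.parts (parts_bd nu) _
    (fun x hx => by rw [Multiset.count_eq_zero_of_notMem hx]; simp)]
  simp [fp, dOf_apply]

open MvPolynomial in
lemma aeval_dOf {n : ℕ} (nu : Nat.Partition n) :
    aeval (fun i : Fin n => hF n (i + 1)) (monomial (dOf nu) (1 : ℚ)) =
      (nu.parts.map (hF n)).prod := by
  rw [Finset.prod_multiset_map_count, prod_parts nu.parts (parts_bd nu) _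
    (fun x hx => by rw [Multiset.count_eq_zero_of_notMem hx]; simp)]
  rw [aeval_monomial, Finsupp.prod_fintype _ _ (by simp)]
  simp [dOf_apply]

lemma kill_h (n m : ℕ) : MvPowerSeries.killCompl Fin.valEmbedding (hPow m) = hF n m := by
  ext d
  rw [MvPowerSeries.coeff_killCompl, coeff_hF]
  have : ((Finsupp.embDomain Fin.valEmbedding d).sum fun _ v => v) = sz d := by
    rw [Finsupp.sum_embDomain, Finsupp.sum_fintype _ _ (by simp)]; rfl
  rw [← this]
  rfl

lemma kill_p (n m : ℕ) (hm : 1 ≤ m) :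
    MvPowerSeries.killCompl Fin.valEmbedding (pPow m) = pF n m := by
  ext d
  rw [MvPowerSeries.coeff_killCompl, pF, map_sum]
  simp only [MvPowerSeries.coeff_monomial]
  change (if ∃ k, Finsupp.embDomain Fin.valEmbedding d = Finsupp.single k m then (1 : ℚ) else 0) = _
  by_cases h : ∃ j : Fin n, d = Finsupp.single j m
  · obtain ⟨j, rfl⟩ := h
    rw [if_pos ⟨j, by simp [Finsupp.embDomain_single]⟩, Finset.sum_eq_single j]
    · simp
    · intro b _ hb
      rw [if_neg]
      intro h
      rw [Finsupp.single_eq_single_iff] at h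
      rcases h with h | h
      · exact hb h.1.symm
      · omega
    · simp
  · rw [if_neg, Finset.sum_eq_zero]
    · intro j _
      rw [if_neg]
      exact fun hj => h ⟨j, hj⟩
    · rintro ⟨k, hk⟩
      apply h
      have hk1 : k ∈ (Finsupp.embDomain Fin.valEmbedding d).support := by
        rw [hk, Finsupp.mem_support_iff, Finsupp.single_eq_same]; omega
      rw [Finsupp.support_embDomain, Finset.mem_map] at hk1
      obtain ⟨j, _, rfl⟩ := hk1
      refine ⟨j, ?_⟩
      rw [← Finsupp.embDomain_single] at hk
      exact Finsupp.embDomain_injective _ hk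

end HP

/-- For `n ≥ 1` and `μ ⊢ n`, the coefficient of `h_μ` in `p_n` equals
`n·(-1)^{l(μ)-1}(l(μ)-1)!/∏ n_i(μ)!`, where the coefficients are given by any
expansion `p_n = ∑ a ν • h_ν` (unique, the `h`'s being a basis). -/
theorem stmt16 (n : ℕ) (hn : 1 ≤ n) (mu : Nat.Partition n)
    (a : Nat.Partition n → ℚ)
    (ha : pPow n = ∑ nu : Nat.Partition n, a nu • hProd nu.parts) :
    a mu = (n : ℚ) * (-1 : ℚ) ^ (mu.parts.card - 1) *
      ((mu.parts.card - 1).factorial : ℚ) / (multFact mu.parts : ℚ) := by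
  have h1 := congrArg (MvPowerSeries.killCompl (Fin.valEmbedding (n := n))) ha
  rw [HP.kill_p n n hn, ← HP.aeval_PP n n hn le_rfl, map_sum] at h1
  have h2 : ∀ nu : Nat.Partition n,
      MvPowerSeries.killCompl (Fin.valEmbedding (n := n)) (a nu • hProd nu.parts) =
      MvPolynomial.aeval (fun i : Fin n => HP.hF n (i + 1))
        (a nu • MvPolynomial.monomial (HP.dOf nu) (1 : ℚ)) := by
    intro nu
    rw [map_smul, map_smul, HP.aeval_dOf, hProd, map_multiset_prod, Multiset.map_map]
    congr 3
    funext m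
    exact HP.kill_h n m
  rw [Finset.sum_congr rfl (fun nu _ => h2 nu), ← map_sum] at h1
  have h3 := congrArg (MvPolynomial.coeff (HP.dOf mu)) (HP.inj_h n h1)
  rw [HP.coeff_PP n n le_rfl, if_pos (HP.wt_dOf mu), HP.sz_dOf, HP.fp_dOf,
    MvPolynomial.coeff_sum, Finset.sum_eq_single mu] at h3
  · rw [h3]; simp
  · intro b _ hb
    rw [MvPolynomial.coeff_smul, MvPolynomial.coeff_monomial,
      if_neg (fun h => hb (HP.dOf_inj h))]
    simp
  · simp
end
end

section
/- For every partition μ of n and every function f : ℕ → ℝ: ∑_{λ⊢n} (f(l(λ))/∏_i n_i(λ)!) ∑_{puzzles μ→λ} ∏_i ((l(μ^i)-1)!/∏_j n_j(μ^i)!) = (1/∏_i n_i(μ)!) ∑_{τ ∈ S_{l(μ)}} f(c(τ)), where c(τ) is the number of cycles of τ. -/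
open Finset
open scoped Classical

noncomputable section

/-- The puzzles of `μ` into the list of parts `l`: tuples `(μ^1,…,μ^k)` with
`μ^i ⊢ l_i` whose combined parts form `μ`. -/
def puzzles (mu : Multiset ℕ) (l : List ℕ) : Finset (Fin l.length → Multiset ℕ) :=
  (Fintype.piFinset fun _ => mu.powerset.toFinset).filter
    (fun g => (∑ i, g i) = mu ∧ ∀ i, (g i).sum = l.get i)


theorem cyc_eq {α : Type*} [Fintype α] [DecidableEq α] (τ : Equiv.Perm α) :
    τ.partition.parts.card + τ.support.card = τ.cycleType.card + Fintype.card α := by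
  rw [Equiv.Perm.parts_partition, Multiset.card_add, Multiset.card_replicate]
  have := τ.support.card_le_univ
  omega

theorem cyc_swap {α : Type*} [Fintype α] [DecidableEq α] (τ : Equiv.Perm α) (x : α)
    (hx : τ x ≠ x) :
    (Equiv.swap x (τ x) * τ).partition.parts.card = τ.partition.parts.card + 1 := by
  set g := τ.cycleOf x with hg
  have hgx : g x = τ x := Equiv.Perm.cycleOf_apply_self τ x
  have hmem : g ∈ τ.cycleFactorsFinset := by
    rw [hg, Equiv.Perm.cycleOf_mem_cycleFactorsFinset_iff]
    simpa using hx
  have hcyc : g.IsCycle := Equiv.Perm.isCycle_cycleOf τ hx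
  have hd := Equiv.Perm.disjoint_mul_inv_of_mem_cycleFactorsFinset hmem
  set r := τ * g⁻¹ with hr
  have hτ : τ = g * r := by rw [← hd.commute.eq, hr]; simp
  have e0 := cyc_eq (Equiv.swap x (τ x) * τ)
  have e1 := cyc_eq τ
  have c1 : τ.cycleType.card = 1 + r.cycleType.card := by
    rw [hτ, hd.symm.cycleType_mul, hcyc.cycleType]; simp [add_comm]
  have s1 : τ.support.card = g.support.card + r.support.card := by
    conv_lhs => rw [hτ]
    exact hd.symm.card_support_mul
  have key : Equiv.swap x (τ x) * τ = (Equiv.swap x (g x) * g) * r := by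
    rw [hgx, mul_assoc, ← hτ]
  by_cases h2 : g (g x) = x
  · have hsw := hcyc.eq_swap_of_apply_apply_eq_self (hgx ▸ hx) h2
    have : Equiv.swap x (τ x) * τ = r := by
      rw [key]; nth_rewrite 2 [hsw]; simp
    have s2 : g.support.card = 2 := by
      rw [hsw]; exact Equiv.Perm.card_support_swap (hgx ▸ hx.symm)
    rw [this] at e0 ⊢
    omega
  · have hc2 := hcyc.swap_mul (hgx ▸ hx) h2
    have s2 := Equiv.Perm.support_swap_mul_eq g x h2
    have hd2 : (Equiv.swap x (g x) * g).Disjoint r := by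
      rw [Equiv.Perm.disjoint_iff_disjoint_support, s2]
      exact Finset.disjoint_of_subset_left Finset.sdiff_subset
        (Equiv.Perm.disjoint_iff_disjoint_support.1 hd.symm)
    have s3 : (Equiv.swap x (g x) * g).support.card + 1 = g.support.card := by
      rw [s2, Finset.sdiff_singleton_eq_erase, Finset.card_erase_add_one]
      rw [Equiv.Perm.mem_support]; exact hgx ▸ hx
    rw [key] at e0 ⊢
    rw [hd2.cycleType_mul, hc2.cycleType, hd2.card_support_mul] at e0
    simp at e0
    omega

theorem cyc_option {α : Type*} [Fintype α] [DecidableEq α] (e : Equiv.Perm α) :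
    Multiset.card (Equiv.Perm.partition (Equiv.optionCongr e)).parts = e.partition.parts.card + 1 := by
  have h : e.optionCongr = e.extendDomain (p := fun o : Option α => o.isSome)
      (Equiv.optionIsSomeEquiv α).symm := by
    ext1 o
    cases o with
    | none => simp [Equiv.Perm.extendDomain_apply_not_subtype]
    | some a =>
      rw [Equiv.Perm.extendDomain_apply_subtype _ _ (by simp)]
      simp [Equiv.optionIsSomeEquiv]
  have e0 := cyc_eq (α := Option α) (Equiv.optionCongr e)
  have e1 := cyc_eq e
  rw [← Equiv.Perm.sum_cycleType] at e0 e1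
  have hc : Equiv.Perm.cycleType (Equiv.optionCongr e) = e.cycleType := by
    rw [h]; exact Equiv.Perm.cycleType_extendDomain _
  rw [hc] at e0
  simp only [Fintype.card_option] at e0
  omega

theorem cyc_decomp {α : Type*} [Fintype α] [DecidableEq α] (e : Equiv.Perm α) (o : Option α) :
    (Equiv.Perm.decomposeOption.symm (o, e)).partition.parts.card =
      e.partition.parts.card + if o = none then 1 else 0 := by
  cases o with
  | none =>
    have h : Equiv.Perm.decomposeOption.symm (none, e) = Equiv.optionCongr e := by
      ext1 o; simp
    rw [h, cyc_option]; simp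
  | some a =>
    have := cyc_swap (Equiv.Perm.decomposeOption.symm (some a, e)) none (by simp)
    have h : Equiv.swap none (Equiv.Perm.decomposeOption.symm (some a, e) none) *
        Equiv.Perm.decomposeOption.symm (some a, e) = Equiv.optionCongr e := by
      simp [← mul_assoc]
    rw [h, cyc_option] at this
    simp only [reduceCtorEq, if_false]
    omega

theorem cyc_congr {α β : Type*} [Fintype α] [DecidableEq α] [Fintype β] [DecidableEq β]
    (e : α ≃ β) (τ : Equiv.Perm α) :
    (e.permCongr τ).partition.parts.card = τ.partition.parts.card := by
  have h : e.permCongr τ = τ.extendDomain (p := fun _ : β => True)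
      (e.trans (Equiv.Set.univ β).symm) := by
    ext1 b
    rw [Equiv.Perm.extendDomain_apply_subtype _ _ trivial]
    rfl
  have e0 := cyc_eq (e.permCongr τ)
  have e1 := cyc_eq τ
  rw [← Equiv.Perm.sum_cycleType] at e0 e1
  have hc : (e.permCongr τ).cycleType = τ.cycleType := by
    rw [h]; exact Equiv.Perm.cycleType_extendDomain _
  rw [hc] at e0
  have := Fintype.card_congr e
  omega

theorem cyc_sum (n : ℕ) (f : ℕ → ℝ) :
    ∑ τ : Equiv.Perm (Fin (n+1)), f τ.partition.parts.card =
    ∑ τ : Equiv.Perm (Fin n), (n * f τ.partition.parts.card + f (τ.partition.parts.card + 1)) := by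
  rw [← Equiv.sum_comp ((finSuccEquiv n).symm.permCongr)]
  simp only [cyc_congr]
  rw [← Equiv.sum_comp Equiv.Perm.decomposeOption.symm, Fintype.sum_prod_type, Finset.sum_comm]
  simp only [cyc_decomp]
  refine Finset.sum_congr rfl fun τ _ => ?_
  rw [Fintype.sum_option]
  simp [add_comm]

theorem cyc_stirling (n : ℕ) (f : ℕ → ℝ) :
    ∑ τ : Equiv.Perm (Fin n), f τ.partition.parts.card =
    ∑ k ∈ range (n+1), (Nat.stirlingFirst n k : ℝ) * f k := by
  induction n generalizing f with
  | zero =>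
    have : ∀ τ : Equiv.Perm (Fin 0), τ.partition.parts.card = 0 := by
      intro τ
      have := cyc_eq τ
      rw [Subsingleton.elim τ 1] at *
      simpa using this
    simp [this]
  | succ n ih =>
    rw [cyc_sum, ih fun c => n * f c + f (c+1)]
    rw [Finset.sum_range_succ' _ (n+1)]
    simp only [Nat.stirlingFirst_succ_succ, Nat.stirlingFirst_succ_zero, mul_add, Nat.cast_add,
      add_mul, Finset.sum_add_distrib, Nat.cast_mul]
    have : ∑ k ∈ range (n+1), (Nat.stirlingFirst n k : ℝ) * (n * f k) =
       ∑ k ∈ range (n+1), n * (Nat.stirlingFirst n (k+1) : ℝ) * f (k+1) := by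
      rw [Finset.sum_range_succ' , Finset.sum_range_succ _ n]
      rw [Nat.stirlingFirst_eq_zero_of_lt (Nat.lt_succ_self n)]
      have : (Nat.stirlingFirst n 0 : ℝ) * (n * f 0) = 0 := by
        cases n <;> simp
      rw [this]
      simp only [Nat.cast_zero, mul_zero, zero_mul]
      congr 1
      exact Finset.sum_congr rfl fun _ _ => by ring
    rw [this]; simp

def stD (n k : ℕ) : ℝ := (Nat.stirlingFirst n k : ℝ) / (n.factorial : ℝ)

theorem stD_zero (n : ℕ) : ((n : ℝ) + 1) * stD (n+1) 0 = n * stD n 0 := by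
  cases n <;> simp [stD]

theorem stD_succ (n k : ℕ) :
    ((n : ℝ) + 1) * stD (n+1) (k+1) = n * stD n (k+1) + stD n k := by
  have h1 : ((n : ℝ) + 1) ≠ 0 := by positivity
  have h2 : (n.factorial : ℝ) ≠ 0 := by positivity
  simp only [stD, Nat.stirlingFirst_succ_succ, Nat.factorial_succ]
  push_cast
  field_simp

theorem stD_aux (L : ℕ) (d e : ℕ → ℝ)
    (h : ∀ b : ℕ, ((b : ℝ) + 1) * d (b+1) = b * d b + e b) :
    ((L : ℝ) + 1) * ∑ p ∈ antidiagonal (L+1), (1 / (p.1 : ℝ)) * d p.2 =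
      L * ∑ p ∈ antidiagonal L, (1 / (p.1 : ℝ)) * d p.2 +
        ∑ p ∈ antidiagonal L, (1 / (p.1 : ℝ)) * e p.2 + d L := by
  have h1 : ((L : ℝ) + 1) * ∑ p ∈ antidiagonal (L+1), (1 / (p.1 : ℝ)) * d p.2 =
      ∑ p ∈ antidiagonal (L+1), ((p.1 : ℝ) / p.1) * d p.2 +
      ∑ p ∈ antidiagonal (L+1), (1 / (p.1 : ℝ)) * (p.2 * d p.2) := by
    rw [Finset.mul_sum, ← Finset.sum_add_distrib]
    refine Finset.sum_congr rfl fun p hp => ?_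
    have : (p.1 : ℝ) + p.2 = L + 1 := by exact_mod_cast mem_antidiagonal.1 hp
    rw [← this]; ring
  have h2 : (L : ℝ) * ∑ p ∈ antidiagonal L, (1 / (p.1 : ℝ)) * d p.2 =
      ∑ p ∈ antidiagonal L, ((p.1 : ℝ) / p.1) * d p.2 +
      ∑ p ∈ antidiagonal L, (1 / (p.1 : ℝ)) * (p.2 * d p.2) := by
    rw [Finset.mul_sum, ← Finset.sum_add_distrib]
    refine Finset.sum_congr rfl fun p hp => ?_
    have : (p.1 : ℝ) + p.2 = L := by exact_mod_cast mem_antidiagonal.1 hp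
    rw [← this]; ring
  have h3 : ∑ p ∈ antidiagonal (L+1), (1 / (p.1 : ℝ)) * (p.2 * d p.2) =
      ∑ p ∈ antidiagonal L, (1 / (p.1 : ℝ)) * (p.2 * d p.2) +
      ∑ p ∈ antidiagonal L, (1 / (p.1 : ℝ)) * e p.2 := by
    rw [Finset.Nat.sum_antidiagonal_succ', ← Finset.sum_add_distrib]
    simp only [Nat.cast_add, Nat.cast_one, h]
    simp [mul_add]
  have h4 : ∑ p ∈ antidiagonal (L+1), ((p.1 : ℝ) / p.1) * d p.2 =
      ∑ p ∈ antidiagonal L, ((p.1 : ℝ) / p.1) * d p.2 + d L := by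
    rw [Finset.Nat.sum_antidiagonal_succ]
    have h5 : ∀ a : ℕ, ((a + 1 : ℕ) : ℝ) / ((a + 1 : ℕ) : ℝ) = 1 := fun a =>
      div_self (by positivity)
    simp only [h5]
    cases L with
    | zero => simp
    | succ L =>
      rw [Finset.Nat.sum_antidiagonal_succ, Finset.Nat.sum_antidiagonal_succ]
      simp only [h5]
      simp [add_comm]
  rw [h1, h2, h3, h4]; ring

theorem stD_conv (L k : ℕ) :
    ∑ p ∈ antidiagonal L, (1 / (p.1 : ℝ)) * stD p.2 k = (k + 1) * stD L (k + 1) := by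
  induction L generalizing k with
  | zero => simp [stD]
  | succ L ih =>
    have h1 : ((L : ℝ) + 1) ≠ 0 := by positivity
    apply mul_left_cancel₀ h1
    cases k with
    | zero =>
      rw [stD_aux L (fun b => stD b 0) (fun _ => 0) (fun b => by simp [stD_zero]), ih]
      have := stD_succ L 0
      simp at this ⊢
      linarith
    | succ k =>
      rw [stD_aux L (fun b => stD b (k+1)) (fun b => stD b k) (fun b => by simp [stD_succ]), ih, ih]
      have := stD_succ L (k+1)
      push_cast at this ⊢
      linear_combination (-(k:ℝ) - 2) * this

theorem multFact_pos (m : Multiset ℕ) : 0 < multFact m :=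
  Finset.prod_pos fun _ _ => Nat.factorial_pos _

theorem multFact_cons (x : ℕ) (m : Multiset ℕ) :
    multFact (x ::ₘ m) = (m.count x + 1) * multFact m := by
  have h : ∀ (s : Multiset ℕ) (t : Finset ℕ), s.toFinset ⊆ t →
      multFact s = ∏ j ∈ t, (s.count j).factorial := by
    intro s t hst
    refine Finset.prod_subset hst fun j _ hj => ?_
    rw [Multiset.count_eq_zero.2 (by simpa using hj)]; rfl
  rw [h (x ::ₘ m) (insert x m.toFinset) (by simp), h m (insert x m.toFinset) (by simp),
    ← Finset.mul_prod_erase _ _ (mem_insert_self x m.toFinset),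
    ← Finset.mul_prod_erase _ _ (mem_insert_self x m.toFinset), Multiset.count_cons_self,
    Nat.factorial_succ, mul_assoc]
  congr 2
  refine Finset.prod_congr rfl fun j hj => ?_
  rw [Multiset.count_cons_of_ne (Finset.ne_of_mem_erase hj)]

theorem count_map_cons_self (x : ℕ) (m : Multiset ℕ) (S : Multiset (Multiset ℕ)) :
    (S.map (Multiset.cons x)).count (x ::ₘ m) = S.count m :=
  Multiset.count_map_eq_count' _ _ (fun _ _ h => (Multiset.cons_inj_right x).1 h) _

theorem count_powerset_mul (s : Multiset ℕ) : ∀ a b : Multiset ℕ, a + b = s →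
    s.powerset.count a * (multFact a * multFact b) = multFact s := by
  induction s using Multiset.induction_on with
  | empty =>
    intro a b h
    obtain ⟨rfl, rfl⟩ := by simpa using h
    simp [multFact]
  | cons x s ih =>
    intro a b h
    rw [Multiset.powerset_cons, Multiset.count_add, multFact_cons]
    by_cases ha : x ∈ a
    · obtain ⟨a, rfl⟩ := Multiset.exists_cons_of_mem ha
      rw [count_map_cons_self]
      have hs : a + b = s := by simpa using h
      have i1 := ih a b hs
      by_cases hb : x ∈ b
      · obtain ⟨b, rfl⟩ := Multiset.exists_cons_of_mem hb
        have i2 := ih (x ::ₘ a) b (by rw [← hs]; simp)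
        have hc : s.count x = a.count x + (b.count x + 1) := by rw [← hs]; simp [add_assoc]
        rw [multFact_cons] at i1 i2 ⊢
        rw [multFact_cons, hc]
        linear_combination (b.count x + 1) * i2 + (a.count x + 1) * i1
      · have hc : s.count x = a.count x := by
          rw [← hs, Multiset.count_add, Multiset.count_eq_zero.2 hb]; rfl
        have h0 : s.powerset.count (x ::ₘ a) = 0 := by
          rw [Multiset.count_eq_zero, Multiset.mem_powerset]
          intro hle
          have := Multiset.count_le_of_le x hle
          simp at this; omega
        rw [h0, multFact_cons, hc]
        linear_combination (a.count x + 1) * i1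
    · have hb : x ∈ b := by
        have : x ∈ a + b := by rw [h]; simp
        simpa [ha] using this
      obtain ⟨b, rfl⟩ := Multiset.exists_cons_of_mem hb
      have hs : a + b = s := by simpa using h
      have i1 := ih a b hs
      have hc : s.count x = b.count x := by
        rw [← hs, Multiset.count_add, Multiset.count_eq_zero.2 ha]; simp
      have h0 : (s.powerset.map (Multiset.cons x)).count a = 0 := by
        rw [Multiset.count_eq_zero, Multiset.mem_map]
        rintro ⟨c, _, rfl⟩
        simp at ha
      rw [h0, multFact_cons, hc]
      linear_combination (b.count x + 1) * i1

theorem sum_powerset_card (s : Multiset ℕ) (F : ℕ → ℝ) :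
    (s.powerset.map fun m => F m.card).sum =
      ∑ j ∈ range (s.card + 1), (s.card.choose j : ℝ) * F j := by
  rw [← Multiset.bind_powerset_len, Multiset.map_bind, Multiset.sum_bind]
  show _ = (Multiset.map _ (Multiset.range (s.card + 1))).sum
  congr 1
  refine Multiset.map_congr rfl fun j _ => ?_
  rw [Multiset.map_congr rfl (g := fun _ => F j)
    (fun m hm => by rw [(Multiset.mem_powersetCard.1 hm).2])]
  simp

theorem sum_splits (s : Multiset ℕ) (F : ℕ → ℝ) :
    ∑ m ∈ s.powerset.toFinset, F m.card / ((multFact m : ℝ) * multFact (s - m)) =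
      (1 / (multFact s : ℝ)) * ∑ j ∈ range (s.card + 1), (s.card.choose j : ℝ) * F j := by
  rw [← sum_powerset_card, Finset.sum_multiset_map_count, Finset.mul_sum]
  refine Finset.sum_congr rfl fun m hm => ?_
  have hle : m ≤ s := by simpa using hm
  have := count_powerset_mul s m (s - m) (add_tsub_cancel_of_le hle)
  have h1 := multFact_pos m
  have h2 := multFact_pos (s - m)
  have h3 := multFact_pos s
  have h1 : (multFact m : ℝ) ≠ 0 := by positivity
  have h2 : (multFact (s-m) : ℝ) ≠ 0 := by positivity
  have h3 : (multFact s : ℝ) ≠ 0 := by positivity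
  have this : (s.powerset.count m : ℝ) * (multFact m * multFact (s-m)) = multFact s := by
    exact_mod_cast this
  rw [nsmul_eq_mul]
  field_simp
  linear_combination (-F m.card) * this

def wt (m : Multiset ℕ) : ℝ := ((m.card - 1).factorial : ℝ) / (multFact m : ℝ)

def tup (k : ℕ) (mu : Multiset ℕ) : Finset (Fin k → Multiset ℕ) :=
  (Fintype.piFinset fun _ => mu.powerset.toFinset).filter
    (fun g => (∑ i, g i) = mu ∧ ∀ i, g i ≠ 0)

theorem mem_pi_of_sum {k : ℕ} {mu : Multiset ℕ} {g : Fin k → Multiset ℕ} (h : ∑ i, g i = mu) :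
    g ∈ Fintype.piFinset fun _ : Fin k => mu.powerset.toFinset := by
  rw [Fintype.mem_piFinset]
  intro i
  simp only [Multiset.mem_toFinset, Multiset.mem_powerset]
  rw [← h]
  exact Finset.single_le_sum (f := g) (fun _ _ => Multiset.zero_le _) (mem_univ i)

theorem mem_tup {k : ℕ} {mu : Multiset ℕ} {g : Fin k → Multiset ℕ} :
    g ∈ tup k mu ↔ (∑ i, g i) = mu ∧ ∀ i, g i ≠ 0 := by
  rw [tup, mem_filter]
  exact ⟨fun h => h.2, fun h => ⟨mem_pi_of_sum h.1, h⟩⟩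

theorem tup_rec (k : ℕ) (mu : Multiset ℕ) :
    ∑ g ∈ tup (k+1) mu, ∏ i, wt (g i) =
      ∑ m ∈ mu.powerset.toFinset, if m = 0 then 0 else
        wt m * ∑ g ∈ tup k (mu - m), ∏ i, wt (g i) := by
  have hf : ∀ H : Multiset ℕ → ℝ, (∑ m ∈ mu.powerset.toFinset, if m = 0 then 0 else H m) =
      ∑ m ∈ mu.powerset.toFinset with m ≠ 0, H m := by
    intro H
    rw [Finset.sum_filter]
    exact Finset.sum_congr rfl fun m _ => by by_cases h : m = 0 <;> simp [h]
  rw [hf]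
  simp only [Finset.mul_sum]
  rw [Finset.sum_sigma']
  refine Finset.sum_nbij' (fun g => ⟨g 0, Fin.tail g⟩) (fun p => Fin.cons p.1 p.2) ?_ ?_ ?_ ?_ ?_
  · intro g hg
    rw [mem_tup, Fin.sum_univ_succ] at hg
    simp only [mem_sigma, mem_filter, Multiset.mem_toFinset, Multiset.mem_powerset, mem_tup]
    refine ⟨⟨?_, hg.2 0⟩, ?_, fun i => hg.2 _⟩
    · rw [← hg.1]; exact Multiset.le_add_right _ _
    · rw [← hg.1, add_tsub_cancel_left]; rfl
  · rintro ⟨m, g⟩ hg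
    simp only [mem_sigma, mem_filter, Multiset.mem_toFinset, Multiset.mem_powerset, mem_tup] at hg
    rw [mem_tup, Fin.sum_univ_succ]
    simp only [Fin.cons_zero, Fin.cons_succ, hg.2.1]
    refine ⟨add_tsub_cancel_of_le hg.1.1, fun i => ?_⟩
    refine Fin.cases ?_ (fun i => ?_) i
    · simpa using hg.1.2
    · simpa using hg.2.2 i
  · intro g _; exact Fin.cons_self_tail g
  · rintro ⟨m, g⟩ _; simp
  · intro g _
    rw [Fin.prod_univ_succ]; rfl

theorem tup_sum (k : ℕ) (mu : Multiset ℕ) :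
    ∑ g ∈ tup k mu, ∏ i, wt (g i) =
      (k.factorial : ℝ) * (Nat.stirlingFirst mu.card k : ℝ) / (multFact mu : ℝ) := by
  induction k generalizing mu with
  | zero =>
    by_cases h : mu = 0
    · subst h
      have : tup 0 0 = univ := by 
        ext g; simp only [mem_tup, mem_univ, iff_true]; simp
      rw [this]; simp [multFact]
    · have : tup 0 mu = ∅ := by
        ext g; simp [mem_tup, Ne.symm h]
      have h2 : mu.card ≠ 0 := by simpa using h
      obtain ⟨c, hc⟩ := Nat.exists_eq_succ_of_ne_zero h2
      rw [this, hc, Nat.stirlingFirst_succ_zero]; simp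
  | succ k ih =>
    rw [tup_rec]
    simp only [ih]
    set F : ℕ → ℝ := fun s => if s = 0 then 0 else
      ((s-1).factorial : ℝ) * (k.factorial * Nat.stirlingFirst (mu.card - s) k) with hF
    have h1 : ∀ m ∈ mu.powerset.toFinset, (if m = 0 then 0 else
        wt m * ((k.factorial : ℝ) * (Nat.stirlingFirst (mu - m).card k : ℝ) / (multFact (mu - m) : ℝ)))
        = F m.card / ((multFact m : ℝ) * multFact (mu - m)) := by
      intro m hm
      have hle : m ≤ mu := by simpa using hm
      by_cases h0 : m = 0
      · simp [h0, hF]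
      · have : m.card ≠ 0 := by simpa using h0
        simp only [hF, h0, this, if_false, wt, Multiset.card_sub hle]
        rw [div_mul_div_comm]
    rw [Finset.sum_congr rfl h1, sum_splits]
    have h2 : ∑ j ∈ range (mu.card + 1), (mu.card.choose j : ℝ) * F j =
        (mu.card.factorial * k.factorial : ℝ) *
        ∑ p ∈ antidiagonal mu.card, (1 / (p.1 : ℝ)) * stD p.2 k := by
      rw [Finset.Nat.sum_antidiagonal_eq_sum_range_succ_mk, Finset.mul_sum]
      refine Finset.sum_congr rfl fun j hj => ?_
      have hj : j ≤ mu.card := by simpa [Nat.lt_succ_iff] using hj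
      cases j with
      | zero => simp [hF]
      | succ j =>
        rw [Nat.cast_choose ℝ hj]
        simp only [hF, stD, Nat.factorial_succ]
        have a1 : ((mu.card - (j+1)).factorial : ℝ) ≠ 0 := by positivity
        have a2 : (j.factorial : ℝ) ≠ 0 := by positivity
        have a3 : ((j : ℝ) + 1) ≠ 0 := by positivity
        simp
        field_simp
    rw [h2, stD_conv, stD, Nat.factorial_succ]
    have a1 : (mu.card.factorial : ℝ) ≠ 0 := by positivity
    push_cast
    field_simp

theorem exists_perm_of_map_eq {k : ℕ} (a b : Fin k → ℕ)
    (h : univ.val.map a = univ.val.map b) : ∃ σ : Equiv.Perm (Fin k), a = b ∘ σ := by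
  have hc : ∀ y, Nonempty ({x // a x = y} ≃ {x // b x = y}) := by
    intro y
    rw [← Fintype.card_eq, Fintype.card_subtype, Fintype.card_subtype]
    have := congrArg (Multiset.count y) h
    rw [Multiset.count_map, Multiset.count_map] at this
    simpa [Finset.card_def, eq_comm] using this
  let e := fun y => (hc y).some
  refine ⟨(Equiv.sigmaFiberEquiv a).symm.trans
    ((Equiv.sigmaCongrRight e).trans (Equiv.sigmaFiberEquiv b)), ?_⟩
  funext x
  exact ((e (a x) ⟨x, rfl⟩).2).symm

theorem card_perm_stab {k : ℕ} (a : Fin k → ℕ) :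
    (univ.filter fun σ : Equiv.Perm (Fin k) => a ∘ σ = a).card =
      multFact (univ.val.map a) := by
  have := DomMulAct.stabilizer_card' (f := a)
  rw [← Fintype.card_subtype, Fintype.card_congr (Equiv.refl _), this, multFact]
  have h1 : (univ.val.map a).toFinset = univ.image a := rfl
  rw [h1]
  refine Finset.prod_congr rfl fun j _ => ?_
  rw [Fintype.card_subtype, Multiset.count_map]
  simp [Finset.card_def, eq_comm]

theorem card_perm_eq {k : ℕ} (a b : Fin k → ℕ) :
    (univ.filter fun σ : Equiv.Perm (Fin k) => b = a ∘ σ).card =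
      if univ.val.map b = univ.val.map a then multFact (univ.val.map a) else 0 := by
  split_ifs with h
  · obtain ⟨σ, rfl⟩ := exists_perm_of_map_eq b a h
    rw [← card_perm_stab]
    refine Finset.card_bij' (fun τ _ => τ * σ⁻¹) (fun τ _ => τ * σ) ?_ ?_ ?_ ?_
    · intro τ hτ
      simp only [mem_filter, mem_univ, true_and] at hτ ⊢
      funext x
      have := congrFun hτ (σ⁻¹ x)
      simpa using this.symm
    · intro τ hτ
      simp only [mem_filter, mem_univ, true_and] at hτ ⊢
      funext x
      have := congrFun hτ (σ x)
      simpa using this.symm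
    · intro τ _; simp
    · intro τ _; simp
  · rw [Finset.card_eq_zero, Finset.filter_eq_empty_iff]
    rintro σ _ rfl
    apply h
    rw [← Multiset.map_map, Multiset.map_univ_val_equiv]

def pre (k : ℕ) (mu : Multiset ℕ) : Finset (Fin k → Multiset ℕ) :=
  (Fintype.piFinset fun _ => mu.powerset.toFinset).filter (fun g => (∑ i, g i) = mu)

theorem mem_pre {k : ℕ} {mu : Multiset ℕ} {g : Fin k → Multiset ℕ} :
    g ∈ pre k mu ↔ (∑ i, g i) = mu := by
  rw [pre, mem_filter]
  exact ⟨fun h => h.2, fun h => ⟨mem_pi_of_sum h, h⟩⟩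

def sums {k : ℕ} (g : Fin k → Multiset ℕ) : Fin k → ℕ := fun i => (g i).sum

theorem pre_perm {k : ℕ} (mu : Multiset ℕ) (a : Fin k → ℕ) (σ : Equiv.Perm (Fin k)) :
    (∑ g ∈ pre k mu, if sums g = a ∘ σ then ∏ i, wt (g i) else 0) =
      ∑ g ∈ pre k mu, if sums g = a then ∏ i, wt (g i) else 0 := by
  refine Finset.sum_nbij' (fun g => g ∘ σ.symm) (fun g => g ∘ σ) ?_ ?_ ?_ ?_ ?_
  · intro g hg
    rw [mem_pre] at hg ⊢
    rw [← hg]; exact Equiv.sum_comp σ.symm g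
  · intro g hg
    rw [mem_pre] at hg ⊢
    rw [← hg]; exact Equiv.sum_comp σ g
  · intro g _; funext i; simp
  · intro g _; funext i; simp
  · intro g _
    have h1 : ∏ i, wt ((g ∘ σ.symm) i) = ∏ i, wt (g i) :=
      Equiv.prod_comp σ.symm fun i => wt (g i)
    have h2 : sums g = a ∘ σ ↔ sums (g ∘ σ.symm) = a := by
      constructor
      · intro h; funext x
        have := congrFun h (σ.symm x)
        simpa [sums] using this
      · rintro rfl; funext x; simp [sums]
    simp only [h1, h2]

theorem pre_orderings {k : ℕ} (mu : Multiset ℕ) (a : Fin k → ℕ) :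
    (k.factorial : ℝ) * (∑ g ∈ pre k mu, if sums g = a then ∏ i, wt (g i) else 0) =
    (multFact (univ.val.map a) : ℝ) *
      ∑ g ∈ pre k mu, if univ.val.map (sums g) = univ.val.map a then ∏ i, wt (g i) else 0 := by
  have h1 : ∑ σ : Equiv.Perm (Fin k),
      (∑ g ∈ pre k mu, if sums g = a ∘ σ then ∏ i, wt (g i) else 0) =
      (k.factorial : ℝ) * (∑ g ∈ pre k mu, if sums g = a then ∏ i, wt (g i) else 0) := by
    simp only [pre_perm]
    simp [Fintype.card_perm]
  rw [← h1, Finset.sum_comm, Finset.mul_sum]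
  refine Finset.sum_congr rfl fun g _ => ?_
  rw [← Finset.sum_filter, Finset.sum_const, card_perm_eq]
  split_ifs <;> simp

theorem puzzles_sum (mu : Multiset ℕ) (l : List ℕ) (k : ℕ) (hk : l.length = k) :
    (1 / (multFact (l : Multiset ℕ) : ℝ)) * (∑ g ∈ puzzles mu l, ∏ i, wt (g i)) =
      (1 / (k.factorial : ℝ)) *
        ∑ g ∈ pre k mu, if univ.val.map (sums g) = (l : Multiset ℕ) then ∏ i, wt (g i) else 0 := by
  subst hk
  have h1 : univ.val.map l.get = (l : Multiset ℕ) := by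
    simp [Fin.univ_val_map]
  have h2 := pre_orderings mu l.get
  rw [h1] at h2
  have h3 : ∑ g ∈ puzzles mu l, ∏ i, wt (g i) =
      ∑ g ∈ pre l.length mu, if sums g = l.get then ∏ i, wt (g i) else 0 := by
    rw [← Finset.sum_filter]
    refine Finset.sum_congr ?_ fun _ _ => rfl
    ext g
    simp only [puzzles, pre, mem_filter, sums, funext_iff, and_assoc]
  rw [h3]
  have := multFact_pos (l : Multiset ℕ)
  have h4 : (multFact (l : Multiset ℕ) : ℝ) ≠ 0 := by positivity
  have h5 : (l.length.factorial : ℝ) ≠ 0 := by positivity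
  field_simp
  linear_combination h2

theorem sum_ne_zero_of_parts {mu m : Multiset ℕ} (hpos : ∀ x ∈ mu, 0 < x) (hm : m ≤ mu) :
    0 < m.sum ↔ m ≠ 0 := by
  constructor
  · rintro h rfl; simp at h
  · intro h
    obtain ⟨x, hx⟩ := Multiset.exists_mem_of_ne_zero h
    exact lt_of_lt_of_le (hpos x (Multiset.mem_of_le hm hx)) (Multiset.le_sum_of_mem hx)

theorem lam_sum (n : ℕ) (mu : Nat.Partition n) (k : ℕ) :
    (∑ lam : Nat.Partition n, ∑ g ∈ pre k mu.parts,
      if univ.val.map (sums g) = lam.parts then ∏ i, wt (g i) else 0) =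
    ∑ g ∈ tup k mu.parts, ∏ i, wt (g i) := by
  rw [Finset.sum_comm]
  have h0 : tup k mu.parts = (pre k mu.parts).filter fun g => ∀ i, g i ≠ 0 := by
    ext g; simp only [mem_filter, mem_tup, mem_pre]
  rw [h0, Finset.sum_filter]
  refine Finset.sum_congr rfl fun g hg => ?_
  rw [mem_pre] at hg
  have hpos : ∀ i, 0 < (g i).sum ↔ g i ≠ 0 := fun i =>
    sum_ne_zero_of_parts (fun x hx => mu.parts_pos hx)
      (by simpa using Fintype.mem_piFinset.1 (mem_pi_of_sum hg) i)
  split_ifs with h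
  · let lam : Nat.Partition n := 
      { parts := univ.val.map (sums g)
        parts_pos := by
          intro i hi
          obtain ⟨j, _, rfl⟩ := Multiset.mem_map.1 hi
          exact (hpos j).2 (h j)
        parts_sum := by
          rw [← mu.parts_sum, ← hg]
          exact (map_sum (Multiset.sumAddMonoidHom (M := ℕ)) g univ).symm }
    rw [Finset.sum_eq_single lam]
    · simp [lam]
    · intro b _ hb
      rw [if_neg]
      intro h; exact hb (Nat.Partition.ext h.symm)
    · simp
  · refine Finset.sum_eq_zero fun lam _ => if_neg fun hl => h fun i => (hpos i).1 ?_
    apply lam.parts_pos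
    rw [← hl]
    exact Multiset.mem_map_of_mem _ (mem_univ i)

theorem part_card_le {n : ℕ} (p : Nat.Partition n) : p.parts.card ≤ n := by
  conv_rhs => rw [← p.parts_sum]
  have := Multiset.card_nsmul_le_sum (s := p.parts) (a := 1) fun x hx => p.parts_pos hx
  simpa using this

theorem stmt18 (n : ℕ) (mu : Nat.Partition n) (f : ℕ → ℝ) :
    ∑ lam : Nat.Partition n, (f lam.parts.card / (multFact lam.parts : ℝ)) *
        ∑ g ∈ puzzles mu.parts lam.parts.toList,
          ∏ i, (((g i).card - 1).factorial : ℝ) / (multFact (g i) : ℝ) =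
      (1 / (multFact mu.parts : ℝ)) *
        ∑ τ : Equiv.Perm (Fin mu.parts.card), f τ.partition.parts.card := by
  have h1 : ∀ lam : Nat.Partition n, (f lam.parts.card / (multFact lam.parts : ℝ)) *
        (∑ g ∈ puzzles mu.parts lam.parts.toList,
          ∏ i, (((g i).card - 1).factorial : ℝ) / (multFact (g i) : ℝ)) =
      ∑ k ∈ range (n+1), (f k / (k.factorial : ℝ)) * ∑ g ∈ pre k mu.parts,
        if univ.val.map (sums g) = lam.parts then ∏ i, wt (g i) else 0 := by
    intro lam
    rw [Finset.sum_eq_single lam.parts.card]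
    · have := puzzles_sum mu.parts lam.parts.toList lam.parts.card (by simp)
      rw [Multiset.coe_toList] at this
      simp only [wt] at this ⊢
      linear_combination f lam.parts.card * this
    · intro k _ hk
      rw [Finset.sum_eq_zero, mul_zero]
      intro g _
      refine if_neg fun h => hk ?_
      rw [← h]; simp
    · intro h
      exact absurd (mem_range.2 (Nat.lt_succ_of_le (part_card_le lam))) h
  rw [Finset.sum_congr rfl fun lam _ => h1 lam, Finset.sum_comm, cyc_stirling]
  simp only [← Finset.mul_sum, lam_sum, tup_sum]
  have h2 : ∑ k ∈ range (mu.parts.card + 1), (Nat.stirlingFirst mu.parts.card k : ℝ) * f k =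
      ∑ k ∈ range (n + 1), (Nat.stirlingFirst mu.parts.card k : ℝ) * f k := by
    refine Finset.sum_subset (range_mono (Nat.succ_le_succ (part_card_le mu))) fun k _ hk => ?_
    rw [Nat.stirlingFirst_eq_zero_of_lt (by simpa using hk)]; simp
  rw [h2, Finset.mul_sum]
  refine Finset.sum_congr rfl fun k _ => ?_
  have h5 : (k.factorial : ℝ) ≠ 0 := by positivity
  field_simp
end
end
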